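/- Let n ≥ 1, λ ∈ ℂ^n, and let A be the diagonal n×n complex matrix with diagonal entries λ_1, …, λ_n. Fix l : Fin n → ℕ, k ∈ ℤ, and j ∈ Fin n with i k + ⟨l,λ⟩ − λ_j ≠ 0, where ⟨l,λ⟩ = Σ_s l_s λ_s. Then the function Φ : ℂ^n × ℝ → ℂ^n defined by Φ(y,t) = (i k + ⟨l,λ⟩ − λ_j)^{-1} (∏_s y_s^{l_s}) e^{i k t} e_j satisfies, for all (y,t), the homological equation ∂_t Φ(y,t) + (D_y Φ(y,t))(A y) − A Φ(y,t) = (∏_s y_s^{l_s}) e^{i k t} e_j, where e_j is the j-th standard basis vector. -/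

import Mathlib

/-- Along a diagonal linear vector field, a monomial is an eigenfunction of the Lie derivative. -/
theorem exists_hasFDerivAt_monomial_diagonal {𝕜 ι : Type*} [NontriviallyNormedField 𝕜] [Fintype ι]
    (lam y : ι → 𝕜) (l : ι → ℕ) (S : Finset ι) :
    ∃ f' : (ι → 𝕜) →L[𝕜] 𝕜, HasFDerivAt (fun z : ι → 𝕜 => ∏ s ∈ S, z s ^ l s) f' y ∧
      f' (fun s => lam s * y s) = (∑ s ∈ S, (l s : 𝕜) * lam s) * ∏ s ∈ S, y s ^ l s := by
  classical
  induction S using Finset.induction_on with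
  | empty => exact ⟨0, by simpa using hasFDerivAt_const (1 : 𝕜) y, by simp⟩
  | insert a S ha ih =>
    obtain ⟨f', hf', hv⟩ := ih
    have hpow : HasFDerivAt (fun z : ι → 𝕜 => z a ^ l a) _ y :=
      (hasFDerivAt_apply (𝕜 := 𝕜) a y).pow (l a)
    refine ⟨_, by simpa only [Finset.prod_insert ha] using hpow.fun_mul hf', ?_⟩
    simp only [Finset.prod_insert ha, Finset.sum_insert ha, add_apply,
      smul_apply, ContinuousLinearMap.proj_apply, hv, smul_eq_mul,
      nsmul_eq_mul]
    rcases Nat.eq_zero_or_pos (l a) with h | h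
    · simp [h]
    · obtain ⟨m, hm⟩ := Nat.exists_eq_succ_of_ne_zero h.ne'
      simp only [hm, Nat.succ_eq_add_one, Nat.add_sub_cancel, pow_succ]
      ring

/-- Solvability of the homological equation on non-resonant pseudomonomials:
if `ik + ⟨l,λ⟩ − λ_j ≠ 0`, then
`Φ(y,t) = (ik + ⟨l,λ⟩ − λ_j)⁻¹ y^l e^{ikt} e_j` satisfies
`∂_t Φ + (D_y Φ)(Ay) − AΦ = y^l e^{ikt} e_j`, where `A = diag λ`. -/
theorem stmt_17 {n : ℕ} (hn : 1 ≤ n) (lam : Fin n → ℂ)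
    (A : Matrix (Fin n) (Fin n) ℂ) (hA : A = Matrix.diagonal lam)
    (l : Fin n → ℕ) (k : ℤ) (j : Fin n)
    (hnr : Complex.I * (k : ℂ) + (∑ s, (l s : ℂ) * lam s) - lam j ≠ 0)
    (Φ : (Fin n → ℂ) → ℝ → (Fin n → ℂ))
    (hΦ : ∀ (y : Fin n → ℂ) (t : ℝ),
      Φ y t = ((Complex.I * (k : ℂ) + (∑ s, (l s : ℂ) * lam s) - lam j)⁻¹
          * (∏ s, y s ^ l s) * Complex.exp (Complex.I * (k : ℂ) * (t : ℂ))) •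
        (Pi.single j 1 : Fin n → ℂ)) :
    ∀ (y : Fin n → ℂ) (t : ℝ),
      deriv (fun τ : ℝ => Φ y τ) t
        + (fderiv ℂ (fun z => Φ z t) y) (A.mulVec y)
        - A.mulVec (Φ y t)
      = ((∏ s, y s ^ l s) * Complex.exp (Complex.I * (k : ℂ) * (t : ℂ))) •
          (Pi.single j 1 : Fin n → ℂ) := by
  intro y t
  set d := Complex.I * (k : ℂ) + (∑ s, (l s : ℂ) * lam s) - lam j with hd
  set E := Complex.exp (Complex.I * (k : ℂ) * (t : ℂ)) with hE
  set P := ∏ s, y s ^ l s with hP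
  obtain ⟨f', hf', hv⟩ := exists_hasFDerivAt_monomial_diagonal lam y l Finset.univ
  have hAv : ∀ v : Fin n → ℂ, A.mulVec v = fun s => lam s * v s := by
    intro v
    ext s
    rw [hA, Matrix.mulVec_diagonal]
  have hexp : HasDerivAt (fun τ : ℝ => Complex.exp (Complex.I * (k : ℂ) * (τ : ℂ)))
      (E * (Complex.I * (k : ℂ))) t := by
    simpa using ((Complex.ofRealCLM.hasDerivAt (x := t)).const_mul (Complex.I * (k : ℂ))).cexp
  have ht : HasDerivAt (fun τ : ℝ => Φ y τ)
      ((d⁻¹ * P * (E * (Complex.I * (k : ℂ)))) • (Pi.single j 1 : Fin n → ℂ)) t := by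
    simp only [hΦ]
    exact (hexp.const_mul (d⁻¹ * P)).smul_const _
  have hy : HasFDerivAt (fun z => Φ z t)
      ((E • d⁻¹ • f').smulRight (Pi.single j 1 : Fin n → ℂ)) y := by
    simp only [hΦ]
    exact ((hf'.const_mul d⁻¹).mul_const E).smul_const _
  rw [ht.deriv, hy.fderiv, hAv, hAv, hΦ]
  ext i
  by_cases hij : i = j
  · subst hij
    simp only [Pi.add_apply, Pi.sub_apply, Pi.smul_apply, ContinuousLinearMap.smulRight_apply,
      smul_apply, hv, smul_eq_mul, Pi.single_eq_same, mul_one]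
    calc _ = d⁻¹ * d * (P * E) := by rw [hd]; ring
      _ = P * E := by rw [inv_mul_cancel₀ hnr, one_mul]
  · simp [hij]
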